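/- arXiv:2106.06205 — 2 statements merged into one kernel-verified Lean document; each statement's English description precedes it below -/
import Mathlib

section
/- For all time warps f, g, h: (g ⊔ h)\f = (g\f) ⊓ (h\f) (as functions on ℕ∞), where ⊓ and ⊔ are the pointwise meet and join. -/
/-- A time warp: a monotone function on `ℕ∞` with `f 0 = 0` and `f ⊤ = ⨆ n : ℕ, f n`. -/
def IsTimeWarp (f : ℕ∞ → ℕ∞) : Prop :=
  Monotone f ∧ f 0 = 0 ∧ f ⊤ = ⨆ n : ℕ, f n

/-- The left residual `f\g`. -/
noncomputable def lres (f g : ℕ∞ → ℕ∞) : ℕ∞ → ℕ∞ := fun p =>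
  if p = 0 then 0
  else if p = ⊤ then sSup {q : ℕ∞ | ∃ m : ℕ, f q ≤ g (m : ℕ∞)}
  else sSup {q : ℕ∞ | f q ≤ g p}

/-- The right residual `g/f`. -/
noncomputable def rres (g f : ℕ∞ → ℕ∞) : ℕ∞ → ℕ∞ := fun p =>
  sInf (g '' {q : ℕ∞ | p ≤ f q})

/-- The greatest time warp `⊤`. -/
noncomputable def twTop : ℕ∞ → ℕ∞ := fun p => if p = 0 then 0 else ⊤

/-- `last f`. -/
noncomputable def lastTW (f : ℕ∞ → ℕ∞) : ℕ∞ := sInf {p : ℕ∞ | f p = f ⊤}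

theorem sSup_inter_of_isLowerSet {α : Type*} [CompleteLinearOrder α] {s t : Set α}
    (hs : IsLowerSet s) (ht : IsLowerSet t) : sSup (s ∩ t) = sSup s ⊓ sSup t := by
  rcases hs.total ht with hst | hts
  · rw [Set.inter_eq_left.2 hst, inf_eq_left.2 (sSup_le_sSup hst)]
  · rw [Set.inter_eq_right.2 hts, inf_eq_right.2 (sSup_le_sSup hts)]

theorem Monotone.isLowerSet_setOf_le {α β : Type*} [Preorder α] [Preorder β] {f : α → β}
    (hf : Monotone f) (b : β) : IsLowerSet {a | f a ≤ b} :=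
  fun _ _ hab ha => (hf hab).trans ha

theorem Monotone.isLowerSet_setOf_exists_le {α β ι : Type*} [Preorder α] [Preorder β]
    {f : α → β} (hf : Monotone f) (b : ι → β) : IsLowerSet {a | ∃ i, f a ≤ b i} :=
  fun _ _ hab ⟨i, hi⟩ => ⟨i, (hf hab).trans hi⟩

theorem stmt6 (f g h : ℕ∞ → ℕ∞) (hf : IsTimeWarp f) (hg : IsTimeWarp g)
    (hh : IsTimeWarp h) :
    lres (g ⊔ h) f = lres g f ⊓ lres h f := by
  obtain ⟨hg, -, -⟩ := hg
  obtain ⟨hh, -, -⟩ := hh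
  funext p
  simp only [lres, Pi.inf_apply]
  split_ifs
  · exact (inf_idem _).symm
  · rw [← sSup_inter_of_isLowerSet (hg.isLowerSet_setOf_exists_le _)
      (hh.isLowerSet_setOf_exists_le _)]
    congr 1
    ext q
    constructor
    · rintro ⟨m, hm⟩
      exact ⟨⟨m, (le_sup_left (a := g q)).trans hm⟩, ⟨m, (le_sup_right (a := g q)).trans hm⟩⟩
    · rintro ⟨⟨m, hm⟩, ⟨n, hn⟩⟩
      refine ⟨max m n, sup_le (hm.trans (hf.1 ?_)) (hn.trans (hf.1 ?_))⟩
      · exact_mod_cast le_max_left m n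
      · exact_mod_cast le_max_right m n
  · rw [← sSup_inter_of_isLowerSet (hg.isLowerSet_setOf_le _) (hh.isLowerSet_setOf_le _)]
    congr 1
    ext q
    exact sup_le_iff (a := g q) (b := h q)
end

section
/- For any time warp f, the following are equivalent: last(f) = ∞; last(fʳ) = ∞; last(fˡ) = ∞. -/
/-- When the value at `⊤` is the supremum of the finite values, `lastTW f = ⊤` says that `f` is
finite-valued and unbounded on `ℕ`. -/
theorem lastTW_eq_top_iff {f : ℕ∞ → ℕ∞} (hf : f ⊤ = ⨆ n : ℕ, f n) :
    lastTW f = ⊤ ↔ (∀ n : ℕ, f n ≠ ⊤) ∧ ∀ n : ℕ, ∃ m : ℕ, (n : ℕ∞) ≤ f m := by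
  constructor
  · intro h
    have lt (n : ℕ) : f n < f ⊤ := by
      refine lt_of_le_of_ne (hf ▸ le_iSup (fun n : ℕ => f n) n) fun e => ?_
      exact ENat.natCast_ne_top n (sInf_eq_top.1 h _ e)
    refine ⟨fun n => (lt n).ne_top, fun n => ?_⟩
    induction n with
    | zero => exact ⟨0, by simp⟩
    | succ n ih =>
      obtain ⟨m, hm⟩ := ih
      have h' := lt m
      rw [hf, lt_iSup_iff] at h'
      obtain ⟨k, hk⟩ := h'
      exact ⟨k, by push_cast; exact Order.add_one_le_of_lt (hm.trans_lt hk)⟩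
  · rintro ⟨hfin, hunb⟩
    have top : f ⊤ = ⊤ := by
      refine ENat.eq_top_iff_forall_ge.2 fun n => ?_
      obtain ⟨m, hm⟩ := hunb n
      exact hm.trans (hf ▸ le_iSup (fun n : ℕ => f n) m)
    refine sInf_eq_top.2 fun p hp => ?_
    induction p using ENat.recTopCoe with
    | top => rfl
    | coe n => exact absurd (Eq.trans hp top) (hfin n)

theorem lres_id_coe (f : ℕ∞ → ℕ∞) {n : ℕ} (hn : n ≠ 0) :
    lres f id n = sSup {q : ℕ∞ | f q ≤ n} := by
  simp [lres, hn]

theorem lres_id_top (f : ℕ∞ → ℕ∞) : lres f id ⊤ = ⨆ n : ℕ, lres f id n := by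
  have top : lres f id ⊤ = sSup {q : ℕ∞ | ∃ m : ℕ, f q ≤ m} := by simp [lres]
  rw [top]
  apply le_antisymm
  · refine sSup_le ?_
    rintro q ⟨m, hm⟩
    refine le_iSup_of_le (m + 1) ?_
    rw [lres_id_coe f m.succ_ne_zero]
    exact le_sSup (hm.trans (by simp))
  · refine iSup_le fun n => ?_
    rcases eq_or_ne n 0 with rfl | hn
    · simp [lres]
    · rw [lres_id_coe f hn]
      exact sSup_le_sSup fun q hq => ⟨n, hq⟩

theorem rres_id (f : ℕ∞ → ℕ∞) (p : ℕ∞) : rres id f p = sInf {q : ℕ∞ | p ≤ f q} := by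
  simp [rres]

theorem le_of_rres_id_le {f : ℕ∞ → ℕ∞} (hf : Monotone f) {p : ℕ∞} {k : ℕ}
    (h : rres id f p ≤ k) : p ≤ f k := by
  have lt : rres id f p < (k + 1 : ℕ) := h.trans_lt (by exact_mod_cast k.lt_succ_self)
  rw [rres_id, sInf_lt_iff] at lt
  obtain ⟨q, hq, hqk⟩ := lt
  exact hq.trans (hf (Order.le_of_lt_add_one (by exact_mod_cast hqk)))

theorem rres_id_top {f : ℕ∞ → ℕ∞} (hf : Monotone f) :
    rres id f ⊤ = ⨆ n : ℕ, rres id f n := by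
  apply le_antisymm
  · rcases eq_or_ne (⨆ n : ℕ, rres id f n) ⊤ with h | h
    · rw [h]; exact le_top
    · obtain ⟨s, hs⟩ := ENat.ne_top_iff_exists.1 h
      rw [← hs, rres_id]
      refine sInf_le (ENat.eq_top_iff_forall_ge.2 fun n => ?_).ge
      exact le_of_rres_id_le hf (hs ▸ le_iSup (fun n : ℕ => rres id f n) n)
  · refine iSup_le fun n => ?_
    rw [rres_id, rres_id]
    exact sInf_le_sInf fun q (hq : ⊤ ≤ f q) => show (n : ℕ∞) ≤ f q from le_top.trans hq

theorem lastTW_lres_id_eq_top_iff {f : ℕ∞ → ℕ∞} (hf : IsTimeWarp f) :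
    lastTW (lres f id) = ⊤ ↔ lastTW f = ⊤ := by
  rw [lastTW_eq_top_iff (lres_id_top f), lastTW_eq_top_iff hf.2.2]
  constructor
  · rintro ⟨hfin, hunb⟩
    refine ⟨fun k hk => ?_, fun n => ?_⟩
    · obtain ⟨m, hm⟩ := hunb (k + 1)
      rcases eq_or_ne m 0 with rfl | hm0
      · simp [lres] at hm
      · rw [lres_id_coe f hm0] at hm
        have lt : (k : ℕ∞) < sSup {q : ℕ∞ | f q ≤ m} :=
          lt_of_lt_of_le (by exact_mod_cast k.lt_succ_self) hm
        obtain ⟨q, hq, hkq⟩ := lt_sSup_iff.1 lt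
        have hfk : f k ≤ m := (hf.1 hkq.le).trans hq
        exact ENat.natCast_ne_top m (top_le_iff.1 (hk ▸ hfk))
    · by_contra! h
      refine hfin (n + 1) ?_
      rw [lres_id_coe f n.succ_ne_zero]
      refine top_le_iff.1 (le_sSup ?_)
      change f ⊤ ≤ _
      rw [hf.2.2]
      exact iSup_le fun m => (h m).le.trans (by simp)
  · rintro ⟨hfin, hunb⟩
    refine ⟨fun n => ?_, fun n => ?_⟩
    · rcases eq_or_ne n 0 with rfl | hn
      · simp [lres]
      · rw [lres_id_coe f hn]
        obtain ⟨m, hm⟩ := hunb (n + 1)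
        refine ne_top_of_le_ne_top (ENat.natCast_ne_top m) (sSup_le fun q hq => ?_)
        by_contra! h
        have hn' := (hm.trans (hf.1 h.le)).trans hq
        exact n.not_succ_le_self (by exact_mod_cast hn')
    · obtain ⟨k, hk⟩ := ENat.ne_top_iff_exists.1 (hfin n)
      refine ⟨k + 1, ?_⟩
      rw [lres_id_coe f k.succ_ne_zero]
      exact le_sSup (hk.symm.le.trans (by simp))

theorem lastTW_rres_id_eq_top_iff {f : ℕ∞ → ℕ∞} (hf : IsTimeWarp f) :
    lastTW (rres id f) = ⊤ ↔ lastTW f = ⊤ := by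
  rw [lastTW_eq_top_iff (rres_id_top hf.1), lastTW_eq_top_iff hf.2.2]
  constructor
  · rintro ⟨hfin, hunb⟩
    refine ⟨fun k hk => ?_, fun n => ?_⟩
    · obtain ⟨m, hm⟩ := hunb (k + 1)
      rw [rres_id] at hm
      have hk' := hm.trans (sInf_le (hk ▸ le_top : (m : ℕ∞) ≤ f k))
      exact k.not_succ_le_self (by exact_mod_cast hk')
    · obtain ⟨k, hk⟩ := ENat.ne_top_iff_exists.1 (hfin n)
      exact ⟨k, le_of_rres_id_le hf.1 hk.ge⟩
  · rintro ⟨hfin, hunb⟩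
    refine ⟨fun n => ?_, fun n => ?_⟩
    · obtain ⟨m, hm⟩ := hunb n
      rw [rres_id]
      exact ne_top_of_le_ne_top (ENat.natCast_ne_top m) (sInf_le hm)
    · obtain ⟨k, hk⟩ := ENat.ne_top_iff_exists.1 (hfin n)
      refine ⟨k + 1, ?_⟩
      rw [rres_id]
      refine le_sInf fun q (hq : ((k + 1 : ℕ) : ℕ∞) ≤ f q) => ?_
      by_contra! h
      have hk' := hq.trans ((hf.1 h.le).trans hk.ge)
      exact k.not_succ_le_self (by exact_mod_cast hk')

theorem stmt17 (f : ℕ∞ → ℕ∞) (hf : IsTimeWarp f) :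
    (lastTW f = ⊤ ↔ lastTW (lres f id) = ⊤) ∧
    (lastTW (lres f id) = ⊤ ↔ lastTW (rres id f) = ⊤) := by
  rw [lastTW_lres_id_eq_top_iff hf, lastTW_rres_id_eq_top_iff hf]
  exact ⟨Iff.rfl, Iff.rfl⟩
end
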